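/- Let (E, F) be a resistance form on a set X whose resistance metric R is complete and such that (X,R) is doubling and uniformly perfect, and assume (E,F) is local. Let A₁, A₂ be nonempty subsets of X with diam(A₁) < ∞ in (X,R) and inf{R(x,y) : x ∈ A₁, y ∈ A₂} > 0, let {V_n}_{n≥0} be a spread sequence of (X,R), and let μ_n be the resistance weights associated with the trace (E|_{V_n}, ℓ(V_n)). Then lim_{n→∞} ∑_{(x,y)∈D_n} (μ_n)_{x,y} = 0, where D_n = ((A₁×A₂) ∪ (A₂×A₁)) ∩ (V_n×V_n). -/

import Mathlib

open Filter Set Metric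
open scoped ENNReal Topology

/-- A resistance form `(E, F)` on a set `X` (Kigami):
`F` is a linear subspace of the real-valued functions on `X`, `E` is a nonnegative
symmetric bilinear form on `F` such that (RF1) constants belong to `F` and
`E(u,u) = 0` iff `u` is constant, (RF2) the quotient of `F` by the constants is a
Hilbert space under `E` (stated as completeness of the `E`-seminorm on `F`),
(RF3) points of `X` are separated by `F`, (RF4) for `x ≠ y` the quantity
`R(x,y) = (inf {E(u,u) : u ∈ F, u x = 1, u y = 0})⁻¹` is finite (i.e. the infimum
is positive; an admissible `u` always exists), and (RF5) the Markov property holds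
for the unit truncation. -/
structure ResistanceForm (X : Type*) where
  F : Set (X → ℝ)
  E : (X → ℝ) → (X → ℝ) → ℝ
  zero_mem : (0 : X → ℝ) ∈ F
  add_mem : ∀ {u v : X → ℝ}, u ∈ F → v ∈ F → u + v ∈ F
  smul_mem : ∀ (c : ℝ) {u : X → ℝ}, u ∈ F → c • u ∈ F
  const_mem : ∀ c : ℝ, (fun _ => c) ∈ F
  symm : ∀ u ∈ F, ∀ v ∈ F, E u v = E v u
  add_left : ∀ u ∈ F, ∀ v ∈ F, ∀ w ∈ F, E (u + v) w = E u w + E v w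
  smul_left : ∀ (c : ℝ), ∀ u ∈ F, ∀ v ∈ F, E (c • u) v = c * E u v
  nonneg : ∀ u ∈ F, 0 ≤ E u u
  null_iff_const : ∀ u ∈ F, (E u u = 0 ↔ ∃ c : ℝ, ∀ x, u x = c)
  complete : ∀ u : ℕ → (X → ℝ), (∀ n, u n ∈ F) →
    (∀ ε : ℝ, 0 < ε → ∃ N : ℕ, ∀ m ≥ N, ∀ n ≥ N, E (u m - u n) (u m - u n) < ε) →
    ∃ v ∈ F, ∀ ε : ℝ, 0 < ε → ∃ N : ℕ, ∀ n ≥ N, E (v - u n) (v - u n) < ε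
  sep : ∀ x y : X, x ≠ y → ∃ u ∈ F, u x ≠ u y
  exists_unit : ∀ x y : X, x ≠ y → ∃ u ∈ F, u x = 1 ∧ u y = 0
  inf_pos : ∀ x y : X, x ≠ y →
    0 < sInf {e : ℝ | ∃ u ∈ F, u x = 1 ∧ u y = 0 ∧ E u u = e}
  markov : ∀ u ∈ F, (fun x => max 0 (min 1 (u x))) ∈ F ∧
    E (fun x => max 0 (min 1 (u x))) (fun x => max 0 (min 1 (u x))) ≤ E u u

namespace ResistanceForm

variable {X : Type*}

open Classical in
/-- The resistance metric `R` associated with a resistance form: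
`R(x,x) = 0` and `R(x,y) = (inf {E(u,u) : u ∈ F, u x = 1, u y = 0})⁻¹` for `x ≠ y`. -/
noncomputable def rmetric (rf : ResistanceForm X) (x y : X) : ℝ :=
  if x = y then 0
  else (sInf {e : ℝ | ∃ u ∈ rf.F, u x = 1 ∧ u y = 0 ∧ rf.E u u = e})⁻¹

open Classical in
/-- The resistance `𝓡(A,B)` between two sets: the reciprocal of the minimal energy of
functions that are `≡ 1` on `A` and `≡ 0` on `B` if such functions exist, `0` if no
such function exists, and `∞` if `A` or `B` is empty. -/
noncomputable def setRes (rf : ResistanceForm X) (A B : Set X) : ℝ≥0∞ :=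
  if A.Nonempty ∧ B.Nonempty then
    (if ∃ u ∈ rf.F, (∀ x ∈ A, u x = 1) ∧ (∀ x ∈ B, u x = 0) then
      (ENNReal.ofReal
        (sInf {e : ℝ | ∃ u ∈ rf.F, (∀ x ∈ A, u x = 1) ∧ (∀ x ∈ B, u x = 0) ∧ rf.E u u = e}))⁻¹
    else 0)
  else ⊤

end ResistanceForm

/-- A distance function `ρ` on `X` is doubling: there is `N ∈ ℕ` such that every ball of
radius `2r` is covered by `N` balls of radius `r`. -/
def DoublingOf {X : Type*} (ρ : X → X → ℝ) : Prop :=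
  ∃ N : ℕ, ∀ (x : X) (r : ℝ), ∃ s : Finset X, s.card ≤ N ∧
    {y : X | ρ x y < 2 * r} ⊆ ⋃ z ∈ s, {y : X | ρ z y < r}

/-- A distance function `ρ` on `X` is uniformly perfect: there is `γ > 1` such that
`B(x, γ r) \ B(x, r) ≠ ∅` whenever `B(x,r)` is not the whole space. -/
def UniformlyPerfectOf {X : Type*} (ρ : X → X → ℝ) : Prop :=
  ∃ γ : ℝ, 1 < γ ∧ ∀ (x : X) (r : ℝ), 0 < r → {y : X | ρ x y < r} ≠ Set.univ →
    ({y : X | ρ x y < γ * r} \ {y : X | ρ x y < r}).Nonempty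

namespace ResistanceForm

/-- The quadratic form of the trace of the resistance form on a subset `Y ⊆ X`:
`E|_Y(f) = inf {E(u,u) : u ∈ F, u|_Y = f|_Y}` (for finite `Y` the trace domain is all of
`ℓ(Y)` and this infimum is attained). -/
noncomputable def traceQ {X : Type*} (rf : ResistanceForm X) (Y : Set X) (f : X → ℝ) : ℝ :=
  sInf {e : ℝ | ∃ u ∈ rf.F, (∀ x ∈ Y, u x = f x) ∧ rf.E u u = e}

open Classical in
/-- `μ` is the family of resistance weights associated with the trace `(E|_V, ℓ(V))` of
the resistance form on a finite set `V ⊆ X`: it is symmetric, the diagonal entries are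
the negated row sums, and the trace energy is reproduced as
`E|_V(f,f) = (1/2) ∑_{x,y ∈ V} (f x - f y)² μ_{x,y}`. -/
def IsResistanceWeights {X : Type*} (rf : ResistanceForm X) (V : Finset X)
    (μ : X → X → ℝ) : Prop :=
  (∀ x y : X, μ x y = μ y x) ∧
  (∀ x ∈ V, μ x x = - ∑ y ∈ V.erase x, μ x y) ∧
  (∀ f : X → ℝ, rf.traceQ (V : Set X) f =
    (1 / 2) * ∑ x ∈ V, ∑ y ∈ V, (f x - f y) * (f x - f y) * μ x y)

/-- A resistance form is local if `E(u,v) = 0` whenever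
`inf {R(x,y) : u x ≠ 0, v y ≠ 0} > 0`. -/
def IsLocal {X : Type*} (rf : ResistanceForm X) : Prop :=
  ∀ u ∈ rf.F, ∀ v ∈ rf.F,
    (∃ δ : ℝ, 0 < δ ∧ ∀ x y : X, u x ≠ 0 → v y ≠ 0 → δ ≤ rf.rmetric x y) →
    rf.E u v = 0

end ResistanceForm

namespace ResistanceForm

section Aux

variable {X : Type*} (rf : ResistanceForm X)

lemma lin_mem (a b : ℝ) {u v : X → ℝ} (hu : u ∈ rf.F) (hv : v ∈ rf.F) :
    a • u + b • v ∈ rf.F :=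
  rf.add_mem (rf.smul_mem a hu) (rf.smul_mem b hv)

lemma sub_mem' {u v : X → ℝ} (hu : u ∈ rf.F) (hv : v ∈ rf.F) : u - v ∈ rf.F := by
  have h := rf.lin_mem 1 (-1) hu hv
  have e : u - v = (1:ℝ) • u + (-1:ℝ) • v := by ext x; simp; ring
  rw [e]; exact h

lemma quad (a b : ℝ) {u v w : X → ℝ} (hu : u ∈ rf.F) (hv : v ∈ rf.F)
    (hw : ∀ x, w x = a * u x + b * v x) :
    rf.E w w = a ^ 2 * rf.E u u + 2 * a * b * rf.E u v + b ^ 2 * rf.E v v := by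
  have e : w = a • u + b • v := by ext x; simp [hw]
  subst e
  have hau := rf.smul_mem a hu
  have hbv := rf.smul_mem b hv
  have hs := rf.add_mem hau hbv
  rw [rf.add_left _ hau _ hbv _ hs, rf.smul_left _ _ hu _ hs, rf.smul_left _ _ hv _ hs,
    rf.symm _ hu _ hs, rf.symm _ hv _ hs, rf.add_left _ hau _ hbv _ hu,
    rf.add_left _ hau _ hbv _ hv, rf.smul_left _ _ hu _ hu, rf.smul_left _ _ hu _ hv,
    rf.smul_left _ _ hv _ hu, rf.smul_left _ _ hv _ hv, rf.symm _ hv _ hu]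
  ring

lemma E_const {u : X → ℝ} (hu : u ∈ rf.F) (c : ℝ) : rf.E u (fun _ => c) = 0 := by
  have hc := rf.const_mem c
  have h0 : rf.E (fun _ : X => c) (fun _ => c) = 0 := (rf.null_iff_const _ hc).2 ⟨c, fun _ => rfl⟩
  have key : ∀ t : ℝ, 0 ≤ rf.E u u + 2 * t * rf.E u (fun _ => c) := by
    intro t
    have h := rf.nonneg _ (rf.lin_mem 1 t hu hc)
    rw [rf.quad 1 t hu hc (fun x => by simp), h0] at h
    linarith
  by_contra hne
  have h := key (-(rf.E u u + 1) / (2 * rf.E u (fun _ => c)))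
  have : 2 * (-(rf.E u u + 1) / (2 * rf.E u (fun _ => c))) * rf.E u (fun _ => c)
      = -(rf.E u u + 1) := by field_simp
  linarith

lemma mem_affine {u w : X → ℝ} (hu : u ∈ rf.F) (a c : ℝ) (hw : ∀ x, w x = a * u x + c) :
    w ∈ rf.F := by
  have h := rf.lin_mem a 1 hu (rf.const_mem c)
  have e : w = a • u + (1:ℝ) • (fun _ => c) := by ext x; simp [hw]
  rw [e]; exact h

lemma E_affine {u w : X → ℝ} (hu : u ∈ rf.F) (a c : ℝ) (hw : ∀ x, w x = a * u x + c) :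
    rf.E w w = a ^ 2 * rf.E u u := by
  have h0 : rf.E (fun _ : X => c) (fun _ => c) = 0 :=
    (rf.null_iff_const _ (rf.const_mem c)).2 ⟨c, fun _ => rfl⟩
  rw [rf.quad a 1 hu (rf.const_mem c) (by simpa using hw), rf.E_const hu, h0]; ring

lemma osc {u : X → ℝ} (hu : u ∈ rf.F) (p q : X) :
    (u p - u q) ^ 2 ≤ rf.E u u * rf.rmetric p q := by
  unfold rmetric
  split_ifs with hpq
  · subst hpq; simp
  have hpos := rf.inf_pos p q hpq
  by_cases hd : u p - u q = 0
  · rw [hd]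
    have h0 := mul_nonneg (rf.nonneg u hu) (inv_nonneg.2 hpos.le)
    simpa using h0
  set w : X → ℝ := fun x => (u p - u q)⁻¹ * u x + (-(u p - u q)⁻¹ * u q) with hw
  have hwF : w ∈ rf.F := rf.mem_affine hu _ _ (fun x => rfl)
  have hwE := rf.E_affine hu _ _ (fun x => (rfl : w x = _))
  have hle : sInf {e : ℝ | ∃ u ∈ rf.F, u p = 1 ∧ u q = 0 ∧ rf.E u u = e} ≤ rf.E w w := by
    apply csInf_le
    · refine ⟨0, ?_⟩
      rintro e ⟨v, hv, -, -, rfl⟩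
      exact rf.nonneg v hv
    · refine ⟨w, hwF, ?_, ?_, rfl⟩
      · simp only [hw]; field_simp; ring
      · simp only [hw]; ring
  rw [hwE] at hle
  rw [← div_eq_mul_inv, le_div_iff₀ hpos]
  calc _ ≤ (u p - u q) ^ 2 * ((u p - u q)⁻¹ ^ 2 * rf.E u u) := by gcongr
    _ = rf.E u u := by field_simp

/-- Closure lemma for increasing constraints with bounded energy. -/
lemma limit_ext (Y : ℕ → Set X) (hY : Monotone Y) (hne : (Y 0).Nonempty) (f : X → ℝ) (M : ℝ)
    (h : ∀ k, ∃ u ∈ rf.F, (∀ x ∈ Y k, u x = f x) ∧ rf.E u u ≤ M) :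
    ∃ v ∈ rf.F, (∀ k, ∀ x ∈ Y k, v x = f x) ∧ rf.E v v ≤ M := by
  set S : ℕ → Set ℝ := fun k => {e : ℝ | ∃ u ∈ rf.F, (∀ x ∈ Y k, u x = f x) ∧ rf.E u u = e}
    with hS
  have hSne : ∀ k, (S k).Nonempty := fun k => by
    obtain ⟨u, hu, h1, -⟩ := h k
    exact ⟨_, u, hu, h1, rfl⟩
  have hSbd : ∀ k, BddBelow (S k) := fun k => ⟨0, by
    rintro e ⟨u, hu, -, rfl⟩; exact rf.nonneg u hu⟩
  have hanti : ∀ k m, k ≤ m → S m ⊆ S k := by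
    rintro k m hkm e ⟨u, hu, h1, rfl⟩
    exact ⟨u, hu, fun x hx => h1 x (hY hkm hx), rfl⟩
  set e : ℕ → ℝ := fun k => sInf (S k) with he
  have emono : Monotone e := fun k m hkm => csInf_le_csInf (hSbd k) (hSne m) (hanti k m hkm)
  have eM : ∀ k, e k ≤ M := fun k => by
    obtain ⟨u, hu, h1, h2⟩ := h k
    exact (csInf_le (hSbd k) ⟨u, hu, h1, rfl⟩).trans h2
  have hlim := tendsto_atTop_ciSup emono ⟨M, by rintro _ ⟨k, rfl⟩; exact eM k⟩
  set L := ⨆ k, e k with hL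
  have eL : ∀ k, e k ≤ L := fun k => le_ciSup ⟨M, by rintro _ ⟨k, rfl⟩; exact eM k⟩ k
  have LM : L ≤ M := ciSup_le eM
  have hw : ∀ k : ℕ, ∃ w ∈ rf.F, (∀ x ∈ Y k, w x = f x) ∧ rf.E w w < e k + 1 / ((k:ℝ) + 1) := by
    intro k
    have : sInf (S k) < e k + 1 / ((k:ℝ) + 1) := by
      have : (0:ℝ) < 1 / ((k:ℝ) + 1) := by positivity
      simp only [he]; linarith
    obtain ⟨_, ⟨w, hw, h1, rfl⟩, h2⟩ := exists_lt_of_csInf_lt (hSne k) this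
    exact ⟨w, hw, h1, h2⟩
  choose w hwF hwf hwE using hw
  have hpar : ∀ k m, k ≤ m → rf.E (w k - w m) (w k - w m) ≤
      2 * (L - e k) + 4 * (1 / ((k:ℝ) + 1)) := by
    intro k m hkm
    have h1 := rf.quad 1 (-1) (hwF k) (hwF m) (w := w k - w m) (fun x => by simp; ring)
    have h2 := rf.quad (1/2) (1/2) (hwF k) (hwF m)
      (w := (1/2 : ℝ) • w k + (1/2 : ℝ) • w m) (fun x => by simp)
    have h3 : e k ≤ rf.E ((1/2 : ℝ) • w k + (1/2 : ℝ) • w m)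
        ((1/2 : ℝ) • w k + (1/2 : ℝ) • w m) := by
      apply csInf_le (hSbd k)
      refine ⟨_, rf.lin_mem _ _ (hwF k) (hwF m), ?_, rfl⟩
      intro x hx
      simp [hwf k x hx, hwf m x (hY hkm hx)]; ring
    have h4 := hwE k
    have h5 := hwE m
    have h6 := eL m
    have h7 : 1 / ((m:ℝ) + 1) ≤ 1 / ((k:ℝ) + 1) := by
      have : (k:ℝ) ≤ m := by exact_mod_cast hkm
      gcongr
    linarith
  have hsymm : ∀ k m, rf.E (w k - w m) (w k - w m) = rf.E (w m - w k) (w m - w k) := by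
    intro k m
    have h1 := rf.quad 1 (-1) (hwF k) (hwF m) (w := w k - w m) (fun x => by simp; ring)
    have h2 := rf.quad (-1) 1 (hwF k) (hwF m) (w := w m - w k) (fun x => by simp; ring)
    rw [h1, h2]; ring
  have htend : Tendsto (fun k : ℕ => 2 * (L - e k) + 4 * (1 / ((k:ℝ) + 1))) atTop (𝓝 0) := by
    have := ((tendsto_const_nhds (x := L)).sub hlim).const_mul 2 |>.add
      ((tendsto_one_div_add_atTop_nhds_zero_nat (𝕜 := ℝ)).const_mul 4)
    simpa using this
  obtain ⟨v, hv, hvlim⟩ := rf.complete w hwF (by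
    intro ε hε
    obtain ⟨N, hN⟩ := eventually_atTop.1 (htend.eventually (gt_mem_nhds hε))
    refine ⟨N, fun m hm n hn => ?_⟩
    rcases le_total m n with hmn | hmn
    · exact (hpar m n hmn).trans_lt (hN m hm)
    · rw [hsymm]; exact (hpar n m hmn).trans_lt (hN n hn))
  have hd0 : Tendsto (fun n => rf.E (v - w n) (v - w n)) atTop (𝓝 0) := by
    rw [Metric.tendsto_atTop]
    intro ε hε
    obtain ⟨N, hN⟩ := hvlim ε hε
    refine ⟨N, fun n hn => ?_⟩
    rw [Real.dist_eq, sub_zero, abs_of_nonneg (rf.nonneg _ (rf.sub_mem' hv (hwF n)))]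
    exact hN n hn
  obtain ⟨o, ho⟩ := hne
  have hconst : ∀ k, ∀ x ∈ Y k, v x - f x = v o - f o := by
    intro k x hx
    have hle : ∀ᶠ n in atTop, ((v x - f x) - (v o - f o)) ^ 2 ≤
        rf.E (v - w n) (v - w n) * rf.rmetric x o := by
      filter_upwards [eventually_ge_atTop k] with n hn
      have := rf.osc (rf.sub_mem' hv (hwF n)) x o
      simpa [hwf n x (hY hn hx), hwf n o (hY (Nat.zero_le n) ho)] using this
    have h0 : ((v x - f x) - (v o - f o)) ^ 2 ≤ 0 := by
      have := hd0.mul_const (rf.rmetric x o)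
      rw [zero_mul] at this
      exact ge_of_tendsto this hle
    have := pow_eq_zero_iff (two_ne_zero) |>.1 (le_antisymm h0 (sq_nonneg _))
    linarith
  have hEv : rf.E v v ≤ M := by
    -- (1+t) inequality: E v ≤ (1+t) E (w n) + (1+1/t) E (v - w n)
    have hgen : ∀ t : ℝ, 0 < t → rf.E v v ≤ (1 + t) * L := by
      intro t ht
      have h1 : ∀ n, rf.E v v ≤ (1 + t) * (e n + 1 / ((n:ℝ) + 1))
          + (1 + 1 / t) * rf.E (v - w n) (v - w n) := by
        intro n
        have hd := rf.sub_mem' hv (hwF n)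
        have h2 := rf.quad 1 1 (hwF n) hd (w := v) (fun x => by simp)
        have h3 := rf.nonneg _ (rf.lin_mem t (-1) (hwF n) hd)
        rw [rf.quad t (-1) (hwF n) hd (fun x => by simp)] at h3
        have h4 : 2 * rf.E (w n) (v - w n) ≤
            t * rf.E (w n) (w n) + 1 / t * rf.E (v - w n) (v - w n) := by
          have : t * rf.E (w n) (w n) + 1 / t * rf.E (v - w n) (v - w n)
            - 2 * rf.E (w n) (v - w n) = (1/t) * (t ^ 2 * rf.E (w n) (w n) +
              2 * t * -1 * rf.E (w n) (v - w n) + (-1) ^ 2 * rf.E (v - w n) (v - w n)) := by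
            field_simp; ring
          have h5 : 0 ≤ (1/t) * (t ^ 2 * rf.E (w n) (w n) +
              2 * t * -1 * rf.E (w n) (v - w n) + (-1) ^ 2 * rf.E (v - w n) (v - w n)) :=
            mul_nonneg (by positivity) h3
          linarith
        have h6 : (1 + t) * rf.E (w n) (w n) ≤ (1 + t) * (e n + 1 / ((n:ℝ) + 1)) :=
          mul_le_mul_of_nonneg_left (hwE n).le (by linarith)
        linarith
      have h2 := ((hlim.add (tendsto_one_div_add_atTop_nhds_zero_nat (𝕜 := ℝ))).const_mul
        (1 + t)).add (hd0.const_mul (1 + 1 / t))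
      simp only [add_zero, mul_zero] at h2
      exact ge_of_tendsto' h2 h1
    have h2 : Tendsto (fun t : ℝ => (1 + t) * L) (𝓝[>] 0) (𝓝 ((1 + 0) * L)) :=
      ((continuous_const.add continuous_id).mul continuous_const).continuousWithinAt
    have h3 : rf.E v v ≤ (1 + 0) * L :=
      ge_of_tendsto h2 (by filter_upwards [self_mem_nhdsWithin] with t ht using hgen t ht)
    linarith
  refine ⟨fun x => 1 * v x + (-(v o - f o)), rf.mem_affine hv _ _ (fun x => rfl), ?_, ?_⟩
  · intro k x hx
    have := hconst k x hx
    dsimp only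
    linarith
  · rw [rf.E_affine hv 1 _ (fun x => rfl)]; linarith

/-- Separation of two sets with energy at most `e`. -/
def Sepa (A B : Set X) (e : ℝ) : Prop :=
  ∃ u ∈ rf.F, (∀ x, 0 ≤ u x) ∧ (∀ x, u x ≤ 1) ∧ (∀ x ∈ A, u x = 1) ∧ (∀ x ∈ B, u x = 0) ∧
    rf.E u u ≤ e

variable {rf}

lemma Sepa.mono {A B A' B' : Set X} {e e' : ℝ} (h : rf.Sepa A B e) (hA : A' ⊆ A) (hB : B' ⊆ B)
    (he : e ≤ e') : rf.Sepa A' B' e' := by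
  obtain ⟨u, hu, h0, h1, h2, h3, h4⟩ := h
  exact ⟨u, hu, h0, h1, fun x hx => h2 x (hA hx), fun x hx => h3 x (hB hx), h4.trans he⟩

lemma Sepa.symm {A B : Set X} {e : ℝ} (h : rf.Sepa A B e) : rf.Sepa B A e := by
  obtain ⟨u, hu, h0, h1, h2, h3, h4⟩ := h
  refine ⟨fun x => (-1) * u x + 1, rf.mem_affine hu _ _ (fun x => rfl), fun x => ?_, fun x => ?_,
    fun x hx => ?_, fun x hx => ?_, ?_⟩
  · have := h1 x; linarith
  · have := h0 x; linarith
  · simp [h3 x hx]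
  · simp [h2 x hx]
  · rw [rf.E_affine hu (-1) 1 (fun x => rfl)]; linarith

lemma sepa_of_le {A B : Set X} {e : ℝ} {u : X → ℝ} (hu : u ∈ rf.F) (h1 : ∀ x ∈ A, 1 ≤ u x)
    (h0 : ∀ x ∈ B, u x ≤ 0) (he : rf.E u u ≤ e) : rf.Sepa A B e := by
  refine ⟨_, (rf.markov u hu).1, fun x => ?_, fun x => ?_, fun x hx => ?_, fun x hx => ?_,
    (rf.markov u hu).2.trans he⟩
  · simp
  · simp
  · have := h1 x hx
    simp [this]
  · have := h0 x hx
    simp [this]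

lemma sepa_empty (A : Set X) : rf.Sepa A ∅ 0 :=
  ⟨fun _ => 1, rf.const_mem 1, by simp, by simp, by simp, by simp,
    ((rf.null_iff_const _ (rf.const_mem 1)).2 ⟨1, fun _ => rfl⟩).le⟩

variable (rf) in
lemma posneg {w : X → ℝ} (hw : w ∈ rf.F) (h1 : ∀ x, w x ≤ 1) (h2 : ∀ x, -1 ≤ w x) :
    (fun x => |w x|) ∈ rf.F ∧ rf.E (fun x => |w x|) (fun x => |w x|) ≤ rf.E w w := by
  set p : X → ℝ := fun x => max 0 (min 1 (w x)) with hp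
  have hpF : p ∈ rf.F := (rf.markov w hw).1
  have hpw : ∀ x, p x = max 0 (w x) := fun x => by simp [hp, h1 x]
  set m : X → ℝ := fun x => 1 * p x + (-1) * w x with hm
  have hmF : m ∈ rf.F := by
    have := rf.lin_mem 1 (-1) hpF hw
    convert this using 1
    ext x; simp [hm]
  have habs : ∀ x, |w x| = 1 * p x + 1 * m x := by
    intro x
    simp only [hm, hpw]
    rcases le_total 0 (w x) with h | h
    · rw [abs_of_nonneg h, max_eq_right h]; ring
    · rw [abs_of_nonpos h, max_eq_left h]; ring
  have hwpm : ∀ x, w x = 1 * p x + (-1) * m x := by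
    intro x; simp only [hm]; ring
  have hcross : ∀ t : ℝ, 0 ≤ t → 0 ≤ -2 * t * rf.E p m + t ^ 2 * rf.E m m := by
    intro t ht
    have hF := rf.lin_mem 1 (-t) hpF hmF
    have hmk := (rf.markov _ hF).2
    have heq : (fun x => max 0 (min 1 (((1:ℝ) • p + (-t) • m) x))) = p := by
      ext x
      simp only [Pi.add_apply, Pi.smul_apply, smul_eq_mul, hm, hpw]
      rcases le_total 0 (w x) with h | h
      · rw [max_eq_right h]
        have : 1 * w x + -t * (1 * w x + -1 * w x) = w x := by ring
        rw [this, min_eq_right (h1 x), max_eq_right h]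
      · rw [max_eq_left h]
        apply max_eq_left
        apply min_le_of_right_le
        nlinarith
    rw [heq, rf.quad 1 (-t) hpF hmF (w := (1:ℝ) • p + (-t) • m) (fun x => by simp)] at hmk
    linarith
  have hneg : rf.E p m ≤ 0 := by
    by_contra hpos
    push Not at hpos
    have hm0 := rf.nonneg _ hmF
    have := hcross (rf.E p m / (rf.E m m + 1)) (by positivity)
    have e1 : -2 * (rf.E p m / (rf.E m m + 1)) * rf.E p m +
        (rf.E p m / (rf.E m m + 1)) ^ 2 * rf.E m m
        = - (rf.E p m) ^ 2 * (rf.E m m + 2) / (rf.E m m + 1) ^ 2 := by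
      field_simp; ring
    rw [e1] at this
    have : 0 < (rf.E p m) ^ 2 * (rf.E m m + 2) / (rf.E m m + 1) ^ 2 := by positivity
    have e2 : - (rf.E p m) ^ 2 * (rf.E m m + 2) / (rf.E m m + 1) ^ 2 =
      -((rf.E p m) ^ 2 * (rf.E m m + 2) / (rf.E m m + 1) ^ 2) := by ring
    linarith
  refine ⟨?_, ?_⟩
  · have := rf.lin_mem 1 1 hpF hmF
    convert this using 1
    ext x; simp [habs]
  · rw [rf.quad 1 1 hpF hmF habs, rf.quad 1 (-1) hpF hmF hwpm]
    linarith

lemma Sepa.union_right {A B C : Set X} {e e' : ℝ} (h : rf.Sepa A B e) (h' : rf.Sepa A C e') :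
    rf.Sepa A (B ∪ C) (e + e') := by
  obtain ⟨u, hu, hu0, hu1, hu2, hu3, hu4⟩ := h
  obtain ⟨v, hv, hv0, hv1, hv2, hv3, hv4⟩ := h'
  have hd : u - v ∈ rf.F := rf.sub_mem' hu hv
  have hsF : u + v ∈ rf.F := rf.add_mem hu hv
  obtain ⟨haF, haE⟩ := rf.posneg hd
    (fun x => by have := hu1 x; have := hv0 x; simp; linarith)
    (fun x => by have := hu0 x; have := hv1 x; simp; linarith)
  set a : X → ℝ := fun x => |(u - v) x| with ha
  have hmin : ∀ x, min (u x) (v x) = (1/2) * (u + v) x + (-1/2) * a x := by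
    intro x
    simp only [ha, Pi.add_apply, Pi.sub_apply]
    rcases le_total (u x) (v x) with h | h
    · rw [min_eq_left h, abs_of_nonpos (by linarith)]; ring
    · rw [min_eq_right h, abs_of_nonneg (by linarith)]; ring
  have hmF : (fun x => min (u x) (v x)) ∈ rf.F := by
    have := rf.lin_mem (1/2) (-1/2) hsF haF
    convert this using 1
    ext x; simp only [hmin]; simp; ring
  refine ⟨fun x => min (u x) (v x), hmF, fun x => le_min (hu0 x) (hv0 x),
    fun x => (min_le_left _ _).trans (hu1 x), fun x hx => ?_, fun x hx => ?_, ?_⟩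
  · simp [hu2 x hx, hv2 x hx]
  · rcases hx with hx | hx
    · simp [hu3 x hx, hv0 x]
    · simp [hv3 x hx, hu0 x]
  · have e1 := rf.quad (1/2) (-1/2) hsF haF hmin
    have e2 := rf.quad 1 1 hu hv (w := u + v) (fun x => by simp)
    have e3 := rf.quad 1 (-1) hu hv (w := u - v) (fun x => by simp; ring)
    have e4 := rf.nonneg _ (rf.lin_mem (1/2) (1/2) hsF haF)
    rw [rf.quad (1/2) (1/2) hsF haF (fun x => by simp; ring)] at e4
    linarith

lemma Sepa.union_left {A B C : Set X} {e e' : ℝ} (h : rf.Sepa A B e) (h' : rf.Sepa C B e') :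
    rf.Sepa (A ∪ C) B (e + e') := (h.symm.union_right h'.symm).symm

lemma sepa_biUnion {ι : Type*} (A : Set X) (B : ι → Set X) (e : ℝ) (s : Finset ι)
    (h : ∀ i ∈ s, rf.Sepa A (B i) e) : rf.Sepa A (⋃ i ∈ s, B i) (s.card * e) := by
  classical
  induction s using Finset.induction_on with
  | empty => simpa using sepa_empty A
  | insert i s hi ih =>
    have h1 := ih (fun j hj => h j (Finset.mem_insert_of_mem hj))
    have h2 := (h i (Finset.mem_insert_self i s)).union_right h1
    refine h2.mono le_rfl ?_ ?_
    · rw [Finset.set_biUnion_insert]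
    · rw [Finset.card_insert_of_notMem hi]; push_cast; linarith

end Aux

section Cut

variable {X : Type*} [MetricSpace X] {rf : ResistanceForm X}

lemma sepa_balls (hR : ∀ x y : X, dist x y = rf.rmetric x y) {p q : X} (hpq : p ≠ q) :
    rf.Sepa (ball p (dist p q / 32)) (ball q (dist p q / 32)) (8 / dist p q) := by
  have hd : 0 < dist p q := dist_pos.2 hpq
  set d := dist p q with hdd
  have hinf : sInf {e : ℝ | ∃ u ∈ rf.F, u p = 1 ∧ u q = 0 ∧ rf.E u u = e} = d⁻¹ := by
    have := hR p q
    rw [rmetric, if_neg hpq] at this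
    rw [hdd, this, inv_inv]
  obtain ⟨u0, hu0, hp0, hq0⟩ := rf.exists_unit p q hpq
  obtain ⟨_, ⟨u, hu, hp, hq, rfl⟩, hlt⟩ :=
    exists_lt_of_csInf_lt (s := {e : ℝ | ∃ u ∈ rf.F, u p = 1 ∧ u q = 0 ∧ rf.E u u = e})
      (b := 2 / d) ⟨_, u0, hu0, hp0, hq0, rfl⟩ (by
        rw [hinf, inv_eq_one_div]; gcongr; norm_num)
  have hosc : ∀ c x : X, dist x c < d / 32 → |u x - u c| ≤ 1 / 4 := by
    intro c x hx
    have h1 := rf.osc hu x c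
    rw [← hR] at h1
    apply abs_le_of_sq_le_sq _ (by norm_num)
    calc _ ≤ _ := h1
      _ ≤ (2 / d) * (d / 32) := by gcongr
      _ = (1/4) ^ 2 := by field_simp; norm_num
  refine sepa_of_le (u := fun x => 2 * u x + (-1/2)) (rf.mem_affine hu _ _ (fun x => rfl)) ?_ ?_ ?_
  · intro x hx
    have := abs_le.1 (hosc p x (mem_ball.1 hx))
    rw [hp] at this
    linarith
  · intro x hx
    have := abs_le.1 (hosc q x (mem_ball.1 hx))
    rw [hq] at this
    linarith
  · rw [rf.E_affine hu 2 _ (fun x => rfl)]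
    have : 8 / d = 4 * (2 / d) := by ring
    linarith

lemma cover_iter {N : ℕ} (hN : ∀ (x : X) (r : ℝ), ∃ s : Finset X, s.card ≤ N ∧
    {y : X | dist x y < 2 * r} ⊆ ⋃ z ∈ s, {y : X | dist z y < r}) (k : ℕ) :
    ∀ (x : X) (r : ℝ), ∃ s : Finset X, s.card ≤ N ^ k ∧
      ball x (2 ^ k * r) ⊆ ⋃ z ∈ s, ball z r := by
  classical
  induction k with
  | zero => intro x r; exact ⟨{x}, by simp, by simp⟩
  | succ k ih =>
    intro x r
    obtain ⟨s, hs, hsub⟩ := ih x (2 * r)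
    choose t ht htsub using fun z => hN z r
    refine ⟨s.biUnion t, ?_, ?_⟩
    · calc _ ≤ s.card * N := Finset.card_biUnion_le_card_mul _ _ _ (fun z _ => ht z)
        _ ≤ N ^ k * N := by gcongr
        _ = _ := by ring
    · intro y hy
      have hy' : y ∈ ball x (2 ^ k * (2 * r)) := by
        convert hy using 2; ring
      obtain ⟨z, hz, hyz⟩ := mem_iUnion₂.1 (hsub hy')
      obtain ⟨z', hz', hyz'⟩ := mem_iUnion₂.1 (htsub z (show dist z y < 2 * r by
        rw [dist_comm]; exact hyz))
      refine mem_iUnion₂.2 ⟨z', Finset.mem_biUnion.2 ⟨z, hz, hz'⟩, ?_⟩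
      rw [mem_ball, dist_comm]; exact hyz'

lemma sepa_annulus (hR : ∀ x y : X, dist x y = rf.rmetric x y) {N : ℕ}
    (hN : ∀ (x : X) (r : ℝ), ∃ s : Finset X, s.card ≤ N ∧
      {y : X | dist x y < 2 * r} ⊆ ⋃ z ∈ s, {y : X | dist z y < r}) (p : X) {s : ℝ} (hs : 0 < s) :
    rf.Sepa (ball p (s / 32)) (ball p (2 * s) \ ball p s) ((N ^ 7 : ℕ) * (8 / s)) := by
  obtain ⟨t, ht, hsub⟩ := cover_iter hN 7 p (s / 64)
  have h1 : ∀ z ∈ t, rf.Sepa (ball p (s / 32)) (ball z (s / 64) \ ball p s) (8 / s) := by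
    intro z _
    rcases (ball z (s / 64) \ ball p s).eq_empty_or_nonempty with h | ⟨q, hq, hqp⟩
    · rw [h]; exact (sepa_empty _).mono le_rfl le_rfl (by positivity)
    have hd : s ≤ dist p q := by
      rw [mem_ball, not_lt, dist_comm] at hqp; exact hqp
    have hpq : p ≠ q := by rintro rfl; simp at hd; linarith
    refine (sepa_balls hR hpq).mono (ball_subset_ball (by linarith)) ?_ (by gcongr)
    intro y hy
    have h2 := mem_ball.1 hy.1
    rw [mem_ball] at hq ⊢
    have := dist_triangle_right y q z
    linarith
  refine (sepa_biUnion _ _ _ t h1).mono le_rfl ?_ ?_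
  · rintro y ⟨hy, hyp⟩
    have hy' : y ∈ ball p (2 ^ 7 * (s / 64)) := by convert hy using 2; ring
    obtain ⟨z, hz, hyz⟩ := mem_iUnion₂.1 (hsub hy')
    exact mem_iUnion₂.2 ⟨z, hz, hyz, hyp⟩
  · gcongr

lemma sepa_annuli (hR : ∀ x y : X, dist x y = rf.rmetric x y) {N : ℕ}
    (hN : ∀ (x : X) (r : ℝ), ∃ s : Finset X, s.card ≤ N ∧
      {y : X | dist x y < 2 * r} ⊆ ⋃ z ∈ s, {y : X | dist z y < r}) (p : X) {s : ℝ} (hs : 0 < s)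
    (k : ℕ) :
    rf.Sepa (ball p (s / 32)) (ball p (2 ^ k * s) \ ball p s)
      ((N ^ 7 : ℕ) * (16 / s) * (1 - 1 / 2 ^ k)) := by
  induction k with
  | zero => simpa using sepa_empty _
  | succ k ih =>
    have h1 : (1:ℝ) ≤ 2 ^ k := one_le_pow₀ (by norm_num)
    have h2 := sepa_annulus hR hN p (s := 2 ^ k * s) (by positivity)
    refine (ih.union_right (h2.mono (A' := ball p (s / 32)) (ball_subset_ball ?_) le_rfl le_rfl)).mono
      le_rfl ?_ ?_
    · have : s ≤ 2 ^ k * s := by nlinarith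
      linarith
    · rintro y ⟨hy, hyp⟩
      by_cases hyk : y ∈ ball p (2 ^ k * s)
      · exact Or.inl ⟨hyk, hyp⟩
      · refine Or.inr ⟨?_, hyk⟩
        convert hy using 2; ring
    · apply le_of_eq
      field_simp
      ring

lemma sepa_compl (hR : ∀ x y : X, dist x y = rf.rmetric x y) {N : ℕ}
    (hN : ∀ (x : X) (r : ℝ), ∃ s : Finset X, s.card ≤ N ∧
      {y : X | dist x y < 2 * r} ⊆ ⋃ z ∈ s, {y : X | dist z y < r}) (p : X) {s : ℝ} (hs : 0 < s) :
    rf.Sepa (ball p (s / 32)) (ball p s)ᶜ ((N ^ 7 : ℕ) * (16 / s)) := by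
  classical
  set f : X → ℝ := fun x => if x ∈ ball p (s / 32) then 1 else 0 with hf
  have hsub : ball p (s / 32) ⊆ ball p s := ball_subset_ball (by linarith)
  obtain ⟨v, hv, hvf, hvE⟩ := rf.limit_ext
    (fun k => ball p (s / 32) ∪ (ball p (2 ^ k * s) \ ball p s))
    (by
      intro k m hkm
      have : (2:ℝ) ^ k ≤ 2 ^ m := pow_le_pow_right₀ (by norm_num) hkm
      apply union_subset_union_right
      apply sdiff_subset_sdiff_left
      apply ball_subset_ball
      gcongr)
    ⟨p, Or.inl (mem_ball_self (by positivity))⟩ f ((N ^ 7 : ℕ) * (16 / s))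
    (by
      intro k
      obtain ⟨u, hu, -, -, h1, h0, hE⟩ := sepa_annuli hR hN p hs k
      refine ⟨u, hu, ?_, hE.trans ?_⟩
      · rintro x (hx | hx)
        · simp only [hf]; rw [if_pos hx]; exact h1 x hx
        · simp only [hf]; rw [if_neg (fun h => hx.2 (hsub h))]; exact h0 x hx
      · have : (0:ℝ) ≤ 1 / 2 ^ k := by positivity
        have h3 : (0:ℝ) ≤ (N ^ 7 : ℕ) * (16 / s) := by positivity
        nlinarith)
  refine sepa_of_le hv ?_ ?_ hvE
  · intro x hx
    rw [hvf 0 x (Or.inl hx)]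
    simp only [hf]; rw [if_pos hx]
  · intro x hx
    obtain ⟨k, hk⟩ := pow_unbounded_of_one_lt (dist x p / s) (one_lt_two)
    rw [hvf k x (Or.inr ⟨by rw [mem_ball]; rwa [div_lt_iff₀ hs] at hk, hx⟩)]
    simp only [hf]; rw [if_neg (fun h => hx (hsub h))]

lemma sepa_sets (hR : ∀ x y : X, dist x y = rf.rmetric x y)
    (hdb : DoublingOf fun x y : X => dist x y) {A B : Set X} (hA : Bornology.IsBounded A)
    {δ : ℝ} (hδ : 0 < δ) (hAB : ∀ x ∈ A, ∀ y ∈ B, δ ≤ dist x y) : ∃ e, rf.Sepa A B e := by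
  obtain ⟨N, hN⟩ := hdb
  rcases A.eq_empty_or_nonempty with rfl | ⟨o, ho⟩
  · exact ⟨0, (sepa_empty B).symm⟩
  obtain ⟨r, hr⟩ := hA.subset_ball o
  obtain ⟨k, hk⟩ := pow_unbounded_of_one_lt (r / (δ / 64)) (one_lt_two)
  rw [div_lt_iff₀ (by positivity)] at hk
  obtain ⟨t, -, ht⟩ := cover_iter hN k o (δ / 64)
  have h1 : ∀ z ∈ t, rf.Sepa B (ball z (δ / 64) ∩ A) ((N ^ 7 : ℕ) * (16 / δ)) := by
    intro z _
    apply Sepa.symm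
    rcases (ball z (δ / 64) ∩ A).eq_empty_or_nonempty with h | ⟨q, hq, hqA⟩
    · rw [h]; exact (sepa_empty B).symm.mono le_rfl le_rfl (by positivity)
    refine (sepa_compl hR hN q hδ).mono ?_ ?_ le_rfl
    · rintro y ⟨hy, -⟩
      rw [mem_ball] at *
      have := dist_triangle_right y q z
      linarith
    · intro y hy
      rw [mem_compl_iff, mem_ball, not_lt, dist_comm]
      exact hAB q hqA y hy
  refine ⟨_, ((sepa_biUnion _ _ _ t h1).mono le_rfl ?_ le_rfl).symm⟩
  intro y hy
  obtain ⟨z, hz, hyz⟩ := mem_iUnion₂.1 (ht (ball_subset_ball hk.le (hr hy)))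
  exact mem_iUnion₂.2 ⟨z, hz, hyz, hy⟩

lemma continuous_of_mem (hR : ∀ x y : X, dist x y = rf.rmetric x y) {u : X → ℝ}
    (hu : u ∈ rf.F) : Continuous u := by
  rw [continuous_iff_continuousAt]
  intro x
  rw [ContinuousAt, tendsto_iff_dist_tendsto_zero]
  have h1 : Tendsto (fun y => Real.sqrt (rf.E u u * dist y x)) (𝓝 x) (𝓝 0) := by
    have : Continuous (fun y => Real.sqrt (rf.E u u * dist y x)) := by fun_prop
    simpa using this.tendsto x
  refine squeeze_zero (fun _ => dist_nonneg) (fun y => ?_) h1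
  rw [Real.dist_eq]
  apply Real.abs_le_sqrt
  rw [hR]; exact rf.osc hu y x

lemma traceQ_le {u : X → ℝ} (hu : u ∈ rf.F) {Y : Set X} {f : X → ℝ} (h : ∀ x ∈ Y, u x = f x) :
    rf.traceQ Y f ≤ rf.E u u :=
  csInf_le ⟨0, by rintro e ⟨u, hu, -, rfl⟩; exact rf.nonneg u hu⟩ ⟨u, hu, h, rfl⟩

lemma tendsto_traceQ (hR : ∀ x y : X, dist x y = rf.rmetric x y)
    (V : ℕ → Finset X) (hmono : Monotone V) (hne : ∀ n, (V n).Nonempty)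
    (hdense : Dense (⋃ n, (V n : Set X))) {u : X → ℝ} (hu : u ∈ rf.F) :
    Tendsto (fun n => rf.traceQ (V n : Set X) u) atTop (𝓝 (rf.E u u)) := by
  have hle : ∀ n, rf.traceQ (V n : Set X) u ≤ rf.E u u := fun n => traceQ_le hu (fun _ _ => rfl)
  have hsne : ∀ n, {e : ℝ | ∃ w ∈ rf.F, (∀ x ∈ (V n : Set X), w x = u x) ∧ rf.E w w = e}.Nonempty :=
    fun n => ⟨_, u, hu, fun _ _ => rfl, rfl⟩
  have hm : Monotone (fun n => rf.traceQ (V n : Set X) u) := by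
    intro n m hnm
    refine le_csInf (hsne m) ?_
    rintro e ⟨w, hw, hwu, rfl⟩
    exact traceQ_le hw (fun x hx => hwu x (hmono hnm hx))
  have hbdd : BddAbove (range (fun n => rf.traceQ (V n : Set X) u)) :=
    ⟨_, by rintro _ ⟨n, rfl⟩; exact hle n⟩
  have hlim := tendsto_atTop_ciSup hm hbdd
  convert hlim using 2
  apply le_antisymm _ (ciSup_le hle)
  apply le_of_forall_pos_le_add
  intro ε hε
  obtain ⟨v, hv, hvu, hvE⟩ := rf.limit_ext (fun n => (V n : Set X))
    (fun n m hnm => by exact_mod_cast hmono hnm) (hne 0) u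
    ((⨆ n, rf.traceQ (V n : Set X) u) + ε) (by
      intro k
      have h1 : rf.traceQ (V k : Set X) u < (⨆ n, rf.traceQ (V n : Set X) u) + ε := by
        have := le_ciSup hbdd k
        linarith
      obtain ⟨_, ⟨w, hw, hwu, rfl⟩, hlt⟩ := exists_lt_of_csInf_lt (hsne k) h1
      exact ⟨w, hw, hwu, hlt.le⟩)
  have : v = u := by
    apply Continuous.ext_on hdense (continuous_of_mem hR hv) (continuous_of_mem hR hu)
    intro x hx
    obtain ⟨n, hn⟩ := mem_iUnion.1 hx
    exact hvu n x hn
  rwa [this] at hvE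

lemma weights_nonneg (hR : ∀ x y : X, dist x y = rf.rmetric x y) {V : Finset X} {μ : X → X → ℝ}
    (hμ : rf.IsResistanceWeights V μ) {x y : X} (hx : x ∈ V) (hy : y ∈ V) (hxy : x ≠ y) :
    0 ≤ μ x y := by
  classical
  obtain ⟨hsym, -, hQ⟩ := hμ
  have hex : ∀ z : X, ∃ u ∈ rf.F, ∀ a ∈ V, u a = if a = z then 1 else 0 := by
    intro z
    have h1 : ∀ a ∈ V.erase z, ∃ e, rf.Sepa {z} {a} e := fun a ha => by
      have haz : z ≠ a := (Finset.ne_of_mem_erase ha).symm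
      have := dist_pos.2 haz
      exact ⟨_, (sepa_balls hR haz).mono (singleton_subset_iff.2 (mem_ball_self (by positivity)))
        (singleton_subset_iff.2 (mem_ball_self (by positivity))) le_rfl⟩
    have h2 : ∀ s : Finset X, s ⊆ V.erase z → ∃ e, rf.Sepa {z} (s : Set X) e := by
      intro s
      induction s using Finset.induction_on with
      | empty => intro _; exact ⟨0, by simpa using sepa_empty _⟩
      | insert a s ha ih =>
        intro hs
        obtain ⟨e, he⟩ := ih ((Finset.subset_insert a s).trans hs)
        obtain ⟨e', he'⟩ := h1 a (hs (Finset.mem_insert_self a s))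
        refine ⟨_, (he'.union_right he).mono le_rfl ?_ le_rfl⟩
        rw [Finset.coe_insert]; rfl
    obtain ⟨e, u, hu, -, -, hu1, hu0, -⟩ := h2 _ le_rfl
    refine ⟨u, hu, fun a ha => ?_⟩
    split_ifs with haz
    · exact hu1 a haz
    · exact hu0 a (by simp [ha, haz])
  obtain ⟨f, hf, hfV⟩ := hex x
  obtain ⟨g, hg, hgV⟩ := hex y
  have hcross : ∀ t : ℝ, 0 ≤ t → rf.traceQ V f ≤ rf.traceQ V (fun a => f a - t * g a) := by
    intro t ht
    refine le_csInf ⟨_, _, rf.lin_mem 1 (-t) hf hg, ?_, rfl⟩ ?_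
    · intro a _; simp; ring
    · rintro e ⟨w, hw, hwV, rfl⟩
      refine (traceQ_le (rf.markov w hw).1 ?_).trans (rf.markov w hw).2
      intro a ha
      rw [hwV a ha]
      dsimp only
      rw [hfV a ha, hgV a ha]
      by_cases hax : a = x
      · subst hax; simp [hxy]
      · simp only [if_neg hax]
        apply max_eq_left
        apply min_le_of_right_le
        split_ifs <;> linarith
  set Bfg := ∑ a ∈ V, ∑ b ∈ V, (f a - f b) * (g a - g b) * μ a b with hB
  have hexp : ∀ t : ℝ, rf.traceQ V (fun a => f a - t * g a) =
      rf.traceQ V f - t * Bfg + t ^ 2 * rf.traceQ V g := by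
    intro t
    rw [hQ, hQ f, hQ g, hB]
    simp only [Finset.mul_sum, ← Finset.sum_add_distrib, ← Finset.sum_sub_distrib]
    refine Finset.sum_congr rfl fun a _ => Finset.sum_congr rfl fun b _ => ?_
    ring
  have hBval : Bfg = -2 * μ x y := by
    have : Bfg = ∑ a ∈ V, ∑ b ∈ V, (-(if a = x then (if b = y then μ a b else 0) else 0)
        - (if a = y then (if b = x then μ a b else 0) else 0)) := by
      refine Finset.sum_congr rfl fun a ha => Finset.sum_congr rfl fun b hb => ?_
      rw [hfV a ha, hfV b hb, hgV a ha, hgV b hb]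
      split_ifs <;> first | (exfalso; apply hxy; subst_vars; rfl) | ring
    rw [this]
    simp only [Finset.sum_sub_distrib, Finset.sum_neg_distrib]
    have hd : ∀ p q : X, p ∈ V → q ∈ V →
        ∑ a ∈ V, ∑ b ∈ V, (if a = p then (if b = q then μ a b else 0) else 0) = μ p q := by
      intro p q hp hq
      rw [Finset.sum_eq_single p]
      · simp [hq]
      · intro a _ ha; simp [ha]
      · intro h; exact absurd hp h
    rw [hd x y hx hy, hd y x hy hx, hsym y x]
    ring
  by_contra hneg
  push Not at hneg
  have hg0 : 0 ≤ rf.traceQ V g := by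
    apply Real.sInf_nonneg
    rintro e ⟨u, hu, -, rfl⟩; exact rf.nonneg u hu
  set c := rf.traceQ V g with hc
  have h1 := hcross (-μ x y / (c + 1)) (div_nonneg (by linarith) (by linarith))
  rw [hexp, hBval] at h1
  have h2 : -μ x y / (c + 1) * (-2 * μ x y) - (-μ x y / (c + 1)) ^ 2 * c =
      (μ x y) ^ 2 * (c + 2) / (c + 1) ^ 2 := by
    field_simp; ring
  have h3 : 0 < (μ x y) ^ 2 * (c + 2) / (c + 1) ^ 2 := by
    have : 0 < (μ x y) ^ 2 := by nlinarith
    positivity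
  linarith

end Cut

end ResistanceForm

/-- Under the standing assumptions, suppose `(E,F)` is local, `A₁, A₂`
are nonempty subsets with `diam A₁ < ∞` and `inf {R(x,y) : x ∈ A₁, y ∈ A₂} > 0`, `{V_n}`
is a spread sequence of `(X,R)`, and `μ_n` are the resistance weights associated with the
trace `(E|_{V_n}, ℓ(V_n))`.  Then `∑_{(x,y) ∈ D_n} (μ_n)_{x,y} → 0`, where
`D_n = (A₁×A₂ ∪ A₂×A₁) ∩ (V_n×V_n)`. -/
theorem tendsto_weights_sum_zero_of_isLocal {X : Type*} [MetricSpace X] [CompleteSpace X]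
    (rf : ResistanceForm X) (hR : ∀ x y : X, dist x y = rf.rmetric x y)
    (hdb : DoublingOf fun x y : X => dist x y)
    (hup : UniformlyPerfectOf fun x y : X => dist x y)
    (hloc : rf.IsLocal)
    (A₁ A₂ : Set X) (h₁ : A₁.Nonempty) (h₂ : A₂.Nonempty)
    (hbd : Bornology.IsBounded A₁)
    (hsep : ∃ δ : ℝ, 0 < δ ∧ ∀ x ∈ A₁, ∀ y ∈ A₂, δ ≤ dist x y)
    (V : ℕ → Finset X) (hmono : Monotone V) (hne : ∀ n, (V n).Nonempty)
    (hdense : Dense (⋃ n, (V n : Set X)))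
    (μn : ℕ → X → X → ℝ) (hμ : ∀ n, rf.IsResistanceWeights (V n) (μn n)) :
    Tendsto (fun n => ∑ x ∈ V n, ∑ y ∈ V n,
        Set.indicator (A₁ ×ˢ A₂ ∪ A₂ ×ˢ A₁) (fun p => μn n p.1 p.2) (x, y))
      atTop (𝓝 0) := by
  obtain ⟨δ, hδ, hsep⟩ := hsep
  obtain ⟨_, u, hu, hu0, -, hu1, huz, -⟩ := ResistanceForm.sepa_sets hR hdb (A := A₁)
    (B := (thickening (δ / 3) A₁)ᶜ) hbd (δ := δ / 3) (by positivity) (by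
      intro x hx y hy
      by_contra h
      push Not at h
      exact hy (mem_thickening_iff.2 ⟨x, hx, by rwa [dist_comm]⟩))
  obtain ⟨_, v, hv, hv0, -, hv1, hvz, -⟩ := (ResistanceForm.sepa_sets hR hdb
    (A := thickening (2 * δ / 3) A₁) (B := A₂) hbd.thickening (δ := δ / 3) (by positivity) (by
      intro x hx y hy
      obtain ⟨a, ha, hxa⟩ := mem_thickening_iff.1 hx
      have h1 := hsep a ha y hy
      have h2 := dist_triangle_left a y x
      linarith)).imp fun _ h => h.symm
  have huT : ∀ x, u x ≠ 0 → x ∈ thickening (δ / 3) A₁ := fun x hx => by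
    by_contra h; exact hx (huz x h)
  have hvT : ∀ x, v x ≠ 0 → x ∉ thickening (2 * δ / 3) A₁ := fun x hx h => hx (hvz x h)
  have hfar : ∀ x y, u x ≠ 0 → v y ≠ 0 → δ / 3 ≤ dist x y := by
    intro x y hx hy
    obtain ⟨a, ha, hxa⟩ := mem_thickening_iff.1 (huT x hx)
    by_contra h
    push Not at h
    refine hvT y hy (mem_thickening_iff.2 ⟨a, ha, ?_⟩)
    have := dist_triangle_left y a x
    linarith
  have hdisj : ∀ x, u x = 0 ∨ v x = 0 := by
    intro x
    by_contra h
    push Not at h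
    have := hfar x x h.1 h.2
    rw [dist_self] at this
    linarith
  have hE0 : rf.E u v = 0 := hloc u hu v hv ⟨δ / 3, by positivity, fun x y hx hy => by
    rw [← hR]; exact hfar x y hx hy⟩
  have hvA1 : ∀ x ∈ A₁, v x = 0 := fun x hx => (hdisj x).resolve_left (by rw [hu1 x hx]; norm_num)
  have huA2 : ∀ x ∈ A₂, u x = 0 := fun x hx => (hdisj x).resolve_right (by rw [hv1 x hx]; norm_num)
  have hne12 : ∀ x ∈ A₁, ∀ y ∈ A₂, x ≠ y := by
    rintro x hx y hy rfl
    have := hsep x hx x hy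
    rw [dist_self] at this; linarith
  have hadd : u + v ∈ rf.F := rf.add_mem hu hv
  have hsub : u - v ∈ rf.F := rf.sub_mem' hu hv
  have hlim : Tendsto (fun n => (1 / 2 : ℝ) * (rf.traceQ (V n : Set X) (u - v) -
      rf.traceQ (V n : Set X) (u + v))) atTop (𝓝 0) := by
    have h := ((ResistanceForm.tendsto_traceQ hR V hmono hne hdense hsub).sub
      (ResistanceForm.tendsto_traceQ hR V hmono hne hdense hadd)).const_mul (1 / 2 : ℝ)
    rw [rf.quad 1 1 hu hv (w := u + v) (fun x => by simp),
      rf.quad 1 (-1) hu hv (w := u - v) (fun x => by simp; ring), hE0] at h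
    convert h using 2
    ring
  refine squeeze_zero (fun n => ?_) (fun n => ?_) hlim
  · refine Finset.sum_nonneg fun x hx => Finset.sum_nonneg fun y hy => ?_
    apply Set.indicator_apply_nonneg
    rintro (⟨h1, h2⟩ | ⟨h1, h2⟩)
    · exact ResistanceForm.weights_nonneg hR (hμ n) hx hy (hne12 _ h1 _ h2)
    · exact ResistanceForm.weights_nonneg hR (hμ n) hx hy (hne12 _ h2 _ h1).symm
  · rw [(hμ n).2.2, (hμ n).2.2]
    simp only [Finset.mul_sum, ← Finset.sum_sub_distrib]
    refine Finset.sum_le_sum fun x hx => Finset.sum_le_sum fun y hy => ?_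
    have heq : (1 / 2 : ℝ) * (1 / 2 * (((u - v) x - (u - v) y) * ((u - v) x - (u - v) y) * μn n x y)
        - 1 / 2 * (((u + v) x - (u + v) y) * ((u + v) x - (u + v) y) * μn n x y))
        = -((u x - u y) * (v x - v y)) * μn n x y := by
      simp only [Pi.add_apply, Pi.sub_apply]; ring
    rw [heq]
    by_cases hmem : (x, y) ∈ A₁ ×ˢ A₂ ∪ A₂ ×ˢ A₁
    · rw [Set.indicator_of_mem hmem]
      rcases hmem with ⟨h1, h2⟩ | ⟨h1, h2⟩
      · dsimp only at h1 h2 ⊢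
        rw [hu1 x h1, huA2 y h2, hvA1 x h1, hv1 y h2]; apply le_of_eq; ring
      · dsimp only at h1 h2 ⊢
        rw [hu1 y h2, huA2 x h1, hvA1 y h2, hv1 x h1]; apply le_of_eq; ring
    · rw [Set.indicator_of_notMem hmem]
      by_cases hxy : x = y
      · subst hxy; simp
      apply mul_nonneg _ (ResistanceForm.weights_nonneg hR (hμ n) hx hy hxy)
      have e1 : u x * v x = 0 := mul_eq_zero.2 (hdisj x)
      have e2 : u y * v y = 0 := mul_eq_zero.2 (hdisj y)
      have e3 := mul_nonneg (hu0 x) (hv0 y)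
      have e4 := mul_nonneg (hu0 y) (hv0 x)
      nlinarith
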